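/- arXiv:2104.00728 — 2 statements merged into one kernel-verified Lean document; each statement's English description precedes it below -/
import Mathlib

section
/- Let σ_j, σ_i, σ_k be Pauli strings on n qubits such that σ_j anticommutes with both σ_i and σ_k (i.e. σ_jσ_i = −σ_iσ_j and σ_jσ_k = −σ_kσ_j). Then tr(⁅σ_j,σ_i⁆ ⁅σ_j,σ_k⁆) = −2^(n+2) if σ_i = σ_k, and tr(⁅σ_j,σ_i⁆ ⁅σ_j,σ_k⁆) = 0 if σ_i ≠ σ_k, where ⁅A,B⁆ = AB − BA denotes the matrix commutator. -/
open Matrix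

/-- The Pauli matrix `X`. -/
noncomputable def PauliX : Matrix (Fin 2) (Fin 2) ℂ := !![0, 1; 1, 0]
/-- The Pauli matrix `Y`. -/
noncomputable def PauliY : Matrix (Fin 2) (Fin 2) ℂ := !![0, -Complex.I; Complex.I, 0]
/-- The Pauli matrix `Z`. -/
noncomputable def PauliZ : Matrix (Fin 2) (Fin 2) ℂ := !![1, 0; 0, -1]

/-- The `n`-fold Kronecker (tensor) product of the one-qubit matrices `f 0, …, f (n-1)`,
realized as a `2ⁿ × 2ⁿ` matrix indexed by `Fin n → Fin 2`. -/
noncomputable def pauliString {n : ℕ} (f : Fin n → Matrix (Fin 2) (Fin 2) ℂ) :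
    Matrix (Fin n → Fin 2) (Fin n → Fin 2) ℂ :=
  Matrix.of fun p q => ∏ i, f i (p i) (q i)

/-- A matrix is a Pauli string on `n` qubits if it is the Kronecker product of `n`
factors, each of which is the identity or one of the Pauli matrices `X`, `Y`, `Z`. -/
def IsPauliString {n : ℕ} (σ : Matrix (Fin n → Fin 2) (Fin n → Fin 2) ℂ) : Prop :=
  ∃ f : Fin n → Matrix (Fin 2) (Fin 2) ℂ,
    (∀ i, f i = 1 ∨ f i = PauliX ∨ f i = PauliY ∨ f i = PauliZ) ∧ σ = pauliString f


theorem pauliString_mul {n : ℕ} (f g : Fin n → Matrix (Fin 2) (Fin 2) ℂ) :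
    pauliString f * pauliString g = pauliString fun i => f i * g i := by
  ext p q
  simp only [pauliString, Matrix.mul_apply, Matrix.of_apply, ← Finset.prod_mul_distrib]
  exact (Fintype.prod_sum fun i r => f i (p i) r * g i r (q i)).symm

theorem pauliString_one {n : ℕ} :
    pauliString (fun _ : Fin n => (1 : Matrix (Fin 2) (Fin 2) ℂ)) = 1 := by
  ext p q
  simp only [pauliString, Matrix.of_apply, Matrix.one_apply, Finset.prod_ite_zero,
    Finset.prod_const_one, Finset.mem_univ, forall_const, funext_iff]

theorem trace_pauliString {n : ℕ} (f : Fin n → Matrix (Fin 2) (Fin 2) ℂ) :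
    (pauliString f).trace = ∏ i, (f i).trace := by
  simp only [pauliString, Matrix.trace, Matrix.diag_apply, Matrix.of_apply]
  exact (Fintype.prod_sum fun i r => f i r r).symm

theorem pauli_mul_self {A : Matrix (Fin 2) (Fin 2) ℂ}
    (hA : A = 1 ∨ A = PauliX ∨ A = PauliY ∨ A = PauliZ) : A * A = 1 := by
  rcases hA with rfl | rfl | rfl | rfl <;>
    simp [PauliX, PauliY, PauliZ, Matrix.one_fin_two]

theorem trace_pauli_mul_of_ne {A B : Matrix (Fin 2) (Fin 2) ℂ}
    (hA : A = 1 ∨ A = PauliX ∨ A = PauliY ∨ A = PauliZ)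
    (hB : B = 1 ∨ B = PauliX ∨ B = PauliY ∨ B = PauliZ) (hAB : A ≠ B) :
    (A * B).trace = 0 := by
  rcases hA with rfl | rfl | rfl | rfl <;> rcases hB with rfl | rfl | rfl | rfl <;>
    first
      | exact absurd rfl hAB
      | simp [PauliX, PauliY, PauliZ, Matrix.trace_fin_two]

theorem IsPauliString.mul_self {n : ℕ} {σ : Matrix (Fin n → Fin 2) (Fin n → Fin 2) ℂ}
    (hσ : IsPauliString σ) : σ * σ = 1 := by
  obtain ⟨f, hf, rfl⟩ := hσ
  simp only [pauliString_mul, pauli_mul_self (hf _), pauliString_one]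

theorem IsPauliString.trace_mul {n : ℕ} {σ τ : Matrix (Fin n → Fin 2) (Fin n → Fin 2) ℂ}
    (hσ : IsPauliString σ) (hτ : IsPauliString τ) :
    (σ * τ).trace = if σ = τ then 2 ^ n else 0 := by
  split_ifs with h
  · rw [← h, hσ.mul_self]
    simp
  · obtain ⟨f, hf, rfl⟩ := hσ
    obtain ⟨g, hg, rfl⟩ := hτ
    obtain ⟨i, hi⟩ := Function.ne_iff.mp fun hfg : f = g => h (congrArg pauliString hfg)
    rw [pauliString_mul, trace_pauliString]
    exact Finset.prod_eq_zero (Finset.mem_univ i) (trace_pauli_mul_of_ne (hf i) (hg i) hi)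

/-- If a Pauli string `σⱼ` anticommutes with Pauli strings `σᵢ` and
`σₖ`, then `tr(⁅σⱼ,σᵢ⁆⁅σⱼ,σₖ⁆) = -2^(n+2)` if `σᵢ = σₖ` and `= 0` otherwise, where
`⁅A,B⁆ = AB - BA`. -/
theorem pauliString_commutator_trace_orthogonality {n : ℕ}
    (σj σi σk : Matrix (Fin n → Fin 2) (Fin n → Fin 2) ℂ)
    (hj : IsPauliString σj) (hi : IsPauliString σi) (hk : IsPauliString σk)
    (hji : σj * σi = -(σi * σj)) (hjk : σj * σk = -(σk * σj)) :
    Matrix.trace ((σj * σi - σi * σj) * (σj * σk - σk * σj)) =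
      if σi = σk then -2 ^ (n + 2) else 0 := by
  have hprod : (σj * σi - σi * σj) * (σj * σk - σk * σj) = (-4 : ℂ) • (σi * σk) := by
    have h₁ : σj * σi - σi * σj = (-2 : ℂ) • (σi * σj) := by rw [hji]; module
    have h₂ : σj * σk - σk * σj = (2 : ℂ) • (σj * σk) := by rw [hjk]; module
    rw [h₁, h₂, smul_mul_smul_comm, mul_assoc, ← mul_assoc σj σj σk, hj.mul_self, one_mul]
    norm_num
  rw [hprod, Matrix.trace_smul, hi.trace_mul hk, smul_eq_mul]
  split_ifs <;> ring
end

section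
/- Let K : ℝ → Matrix(N,N,ℂ) be a differentiable map with K(t) unitary for every t, and let v, H be N×N complex matrices. Then the derivative of the function t ↦ tr(K(t) v K(t)ᴴ H) equals tr( ⁅K(t)ᴴ K′(t), v⁆ · (K(t)ᴴ H K(t)) ), where K′(t) is the derivative of K at t, ⁅A,B⁆ = AB − BA, and Aᴴ denotes the conjugate transpose. -/
open Matrix

theorem Matrix.hasDerivAt_mul_apply {l m n : Type*} [Fintype m]
    {A : ℝ → Matrix l m ℂ} {B : ℝ → Matrix m n ℂ} {A' : Matrix l m ℂ} {B' : Matrix m n ℂ} {t : ℝ}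
    (hA : ∀ a b, HasDerivAt (fun s => A s a b) (A' a b) t)
    (hB : ∀ a b, HasDerivAt (fun s => B s a b) (B' a b) t) (a : l) (b : n) :
    HasDerivAt (fun s => (A s * B s) a b) ((A' * B t + A t * B') a b) t := by
  simp only [Matrix.add_apply, Matrix.mul_apply, ← Finset.sum_add_distrib]
  exact HasDerivAt.fun_sum fun j _ => (hA a j).mul (hB j b)

theorem Matrix.hasDerivAt_conjTranspose_apply {m n : Type*}
    {A : ℝ → Matrix m n ℂ} {A' : Matrix m n ℂ} {t : ℝ}
    (hA : ∀ a b, HasDerivAt (fun s => A s a b) (A' a b) t) (a : n) (b : m) :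
    HasDerivAt (fun s => (A s)ᴴ a b) (A'ᴴ a b) t :=
  (hA b a).star

theorem Matrix.hasDerivAt_trace {n : Type*} [Fintype n]
    {A : ℝ → Matrix n n ℂ} {A' : Matrix n n ℂ} {t : ℝ}
    (hA : ∀ a b, HasDerivAt (fun s => A s a b) (A' a b) t) :
    HasDerivAt (fun s => (A s).trace) A'.trace t :=
  HasDerivAt.fun_sum fun i _ => hA i i

/-- The derivative of a differentiable family of unitary matrices satisfies
`K'ᴴ = -(Kᴴ K' Kᴴ)`. -/
theorem Matrix.conjTranspose_deriv_of_unitary {n : Type*} [Fintype n] [DecidableEq n]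
    {K : ℝ → Matrix n n ℂ} {K' : Matrix n n ℂ} {t : ℝ}
    (hK : ∀ a b, HasDerivAt (fun s => K s a b) (K' a b) t)
    (hunitary : ∀ s, K s ∈ unitary (Matrix n n ℂ)) :
    K'ᴴ = -((K t)ᴴ * K' * (K t)ᴴ) := by
  have hleft (s : ℝ) : (K s)ᴴ * K s = 1 := Unitary.star_mul_self_of_mem (hunitary s)
  have hright : K t * (K t)ᴴ = 1 := Unitary.mul_star_self_of_mem (hunitary t)
  have hzero : K'ᴴ * K t + (K t)ᴴ * K' = 0 := by
    ext a b
    have h := hasDerivAt_mul_apply (hasDerivAt_conjTranspose_apply hK) hK a b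
    simp only [hleft] at h
    exact h.unique (hasDerivAt_const t _)
  calc K'ᴴ = K'ᴴ * K t * (K t)ᴴ := by rw [Matrix.mul_assoc, hright, Matrix.mul_one]
    _ = -((K t)ᴴ * K' * (K t)ᴴ) := by rw [eq_neg_of_add_eq_zero_left hzero, Matrix.neg_mul]

/-- Let `K : ℝ → Matrix N N ℂ` be a differentiable (entrywise) map
with `K t` unitary for every `t`, and let `v, H` be `N × N` complex matrices.  Then
the derivative of `t ↦ tr(K(t) v K(t)ᴴ H)` equals
`tr(⁅K(t)ᴴ K′(t), v⁆ · (K(t)ᴴ H K(t)))`, where `K′` is the (entrywise) derivative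
of `K` and `⁅A,B⁆ = AB - BA`. -/
theorem deriv_trace_conj {N : ℕ}
    (K K' : ℝ → Matrix (Fin N) (Fin N) ℂ)
    (hK : ∀ t : ℝ, ∀ a b : Fin N, HasDerivAt (fun s : ℝ => K s a b) (K' t a b) t)
    (hunitary : ∀ t : ℝ, K t ∈ unitary (Matrix (Fin N) (Fin N) ℂ))
    (v H : Matrix (Fin N) (Fin N) ℂ) (t : ℝ) :
    HasDerivAt (fun s : ℝ => Matrix.trace (K s * v * (K s)ᴴ * H))
      (Matrix.trace
        (((K t)ᴴ * K' t * v - v * ((K t)ᴴ * K' t)) * ((K t)ᴴ * H * K t))) t := by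
  have hconst (M : Matrix (Fin N) (Fin N) ℂ) (a b : Fin N) :
      HasDerivAt (fun _ : ℝ => M a b) ((0 : Matrix (Fin N) (Fin N) ℂ) a b) t :=
    hasDerivAt_const t _
  have hright : K t * (K t)ᴴ = 1 := Unitary.mul_star_self_of_mem (hunitary t)
  have hderiv := hasDerivAt_trace <| hasDerivAt_mul_apply
    (hasDerivAt_mul_apply (hasDerivAt_mul_apply (hK t) (hconst v))
      (hasDerivAt_conjTranspose_apply (hK t))) (hconst H)
  convert hderiv using 1
  have hfirst : ((K t)ᴴ * K' t * v * ((K t)ᴴ * H * K t)).trace =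
      (K' t * v * (K t)ᴴ * H).trace := by
    rw [← Matrix.mul_assoc, Matrix.trace_mul_comm]
    simp only [← Matrix.mul_assoc, hright, Matrix.one_mul]
  have hsecond : (v * ((K t)ᴴ * K' t) * ((K t)ᴴ * H * K t)).trace =
      (K t * v * (K t)ᴴ * K' t * (K t)ᴴ * H).trace := by
    rw [← Matrix.mul_assoc, Matrix.trace_mul_comm]
    simp only [← Matrix.mul_assoc]
  rw [conjTranspose_deriv_of_unitary (hK t) hunitary, Matrix.sub_mul, Matrix.trace_sub,
    hfirst, hsecond]
  simp only [Matrix.mul_zero, add_zero, Matrix.add_mul, Matrix.mul_neg, Matrix.neg_mul,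
    Matrix.trace_add, Matrix.trace_neg, ← Matrix.mul_assoc, sub_eq_add_neg]
end
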